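/- For every complex q with |q| < 1: ∑_{n≥0} q^n/(1 − q^{5n+2}) − ∑_{n≥0} q^{4n+2}/(1 − q^{5n+3}) = (q^5, q^5; q^5)_∞ / (q, q^4; q^5)_∞. -/

import Mathlib

/-!
Common definitions: for a partition `π` of `n`,
`numParts` is the number of parts, `largestPart` the largest part,
`omegaOnes` the number of parts equal to 1, `rank` and `crank` the
Dyson rank and Andrews–Garvan crank.  `NT m j n` is the total number of
parts over partitions of `n` with rank ≡ m (mod j), and `Mw m j n` is
the total number of ones over partitions of `n` with crank ≡ m (mod j).
`poch a q = (a; q)_∞ = ∏_{n ≥ 0} (1 - a qⁿ)`.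
-/

namespace Beck

/-- number of parts of a partition -/
def numParts {n : ℕ} (π : n.Partition) : ℕ := Multiset.card π.parts

/-- largest part of a partition (0 for the empty partition) -/
def largestPart {n : ℕ} (π : n.Partition) : ℕ := π.parts.sup

/-- number of ones in a partition -/
def omegaOnes {n : ℕ} (π : n.Partition) : ℕ := π.parts.count 1

/-- number of parts strictly larger than the number of ones -/
def muParts {n : ℕ} (π : n.Partition) : ℕ :=
  Multiset.card (π.parts.filter fun x => omegaOnes π < x)

/-- Dyson's rank: largest part minus number of parts -/
def rank {n : ℕ} (π : n.Partition) : ℤ :=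
  (largestPart π : ℤ) - (numParts π : ℤ)

/-- the Andrews–Garvan crank -/
def crank {n : ℕ} (π : n.Partition) : ℤ :=
  if omegaOnes π = 0 then (largestPart π : ℤ)
  else (muParts π : ℤ) - (omegaOnes π : ℤ)

/-- `NT m j n`: total number of parts in partitions of `n` with rank ≡ m (mod j) -/
def NT (m j n : ℕ) : ℤ :=
  ∑ π : n.Partition,
    if rank π % (j : ℤ) = (m : ℤ) % (j : ℤ) then (numParts π : ℤ) else 0

/-- `Mw m j n`: total number of ones in partitions of `n` with crank ≡ m (mod j) -/
def Mw (m j n : ℕ) : ℤ :=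
  ∑ π : n.Partition,
    if crank π % (j : ℤ) = (m : ℤ) % (j : ℤ) then (omegaOnes π : ℤ) else 0

/-- `(a; q)_∞ = ∏_{n ≥ 0} (1 - a qⁿ)` -/
noncomputable def poch (a q : ℂ) : ℂ := ∏' n : ℕ, (1 - a * q ^ n)

open Filter Topology Finset

/-- `(a; q)_n = ∏_{i < n} (1 - a qⁱ)` -/
noncomputable def finPoch (a q : ℂ) (n : ℕ) : ℂ := ∏ i ∈ range n, (1 - a * q ^ i)

lemma summable_norm_mul_pow {q : ℂ} (hq : ‖q‖ < 1) (a : ℂ) :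
    Summable fun n : ℕ => ‖-(a * q ^ n)‖ := by
  simpa using (summable_geometric_of_lt_one (norm_nonneg q) hq).mul_left ‖a‖

lemma tendsto_finPoch {q : ℂ} (hq : ‖q‖ < 1) (a : ℂ) :
    Tendsto (finPoch a q) atTop (𝓝 (poch a q)) := by
  have h := multipliable_one_add_of_summable (summable_norm_mul_pow hq a)
  simp only [← sub_eq_add_neg] at h
  exact h.tendsto_prod_tprod_nat

lemma poch_ne_zero {q a : ℂ} (hq : ‖q‖ < 1) (ha : ∀ n : ℕ, 1 - a * q ^ n ≠ 0) :
    poch a q ≠ 0 := by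
  have h := tprod_one_add_ne_zero_of_summable (f := fun n : ℕ => -(a * q ^ n))
    (by simpa [sub_eq_add_neg] using ha) (summable_norm_mul_pow hq a)
  simpa [poch, sub_eq_add_neg] using h

lemma one_sub_mul_pow_ne_zero {q a : ℂ} (hq : ‖q‖ < 1) (ha : ‖a‖ < 1) (n : ℕ) :
    1 - a * q ^ n ≠ 0 := by
  intro h
  have h1 : ‖a * q ^ n‖ = 1 := by rw [← sub_eq_zero.mp h, norm_one]
  rw [norm_mul, norm_pow] at h1
  have h2 : ‖a‖ * ‖q‖ ^ n ≤ ‖a‖ :=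
    mul_le_of_le_one_right (norm_nonneg a) (pow_le_one₀ (norm_nonneg q) hq.le)
  linarith

lemma finPoch_ne_zero {q a : ℂ} (ha : ∀ n : ℕ, 1 - a * q ^ n ≠ 0) (n : ℕ) :
    finPoch a q n ≠ 0 :=
  prod_ne_zero_iff.mpr fun i _ => ha i

lemma prod_low_factors {p x : ℂ} (hx : x ≠ 0) (w : ℂ) (K : ℕ) :
    ∏ j ∈ range K, (p ^ K * w - x * p ^ j)
      = x ^ K * (∏ j ∈ range K, -p ^ j) * finPoch (p * w / x) p K := by
  rw [finPoch, ← prod_range_reflect (fun i => 1 - p * w / x * p ^ i),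
    show x ^ K = ∏ _j ∈ range K, x by simp, ← prod_mul_distrib, ← prod_mul_distrib]
  refine prod_congr rfl fun j hj => ?_
  have hj' := mem_range.mp hj
  have : p ^ K = p ^ j * p * p ^ (K - 1 - j) := by
    rw [← pow_succ, ← pow_add]; congr 1; omega
  rw [this]
  field_simp
  ring

lemma prod_high_factors {w : ℂ} (hw : w ≠ 0) (p x : ℂ) (K L : ℕ) :
    ∏ j ∈ range L, (p ^ K * w - x * p ^ (K + j)) = (p ^ K * w) ^ L * finPoch (x / w) p L := by
  rw [finPoch, show (p ^ K * w) ^ L = ∏ _j ∈ range L, p ^ K * w by simp, ← prod_mul_distrib]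
  refine prod_congr rfl fun j _ => ?_
  rw [pow_add]
  field_simp

lemma pow_injective_of_norm_lt_one {p : ℂ} (hp0 : p ≠ 0) (hp : ‖p‖ < 1) :
    Function.Injective fun n : ℕ => p ^ n := by
  intro m n h
  have h' : ‖p‖ ^ m = ‖p‖ ^ n := by simpa using congrArg norm h
  exact pow_right_injective₀ (norm_pos_iff.mpr hp0) hp.ne h'

lemma partial_fractions {p x z : ℂ} (hp0 : p ≠ 0) (hp : ‖p‖ < 1) (hx : x ≠ 0) (M : ℕ)
    (hz : ∀ m ∈ range (M + 1), z ≠ p ^ m) :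
    ∏ j ∈ range M, (z - x * p ^ j) = (∏ j ∈ range (M + 1), (z - p ^ j)) *
      ∑ m ∈ range (M + 1), x ^ m * (finPoch x p (M - m) / finPoch p p (M - m)) *
        (finPoch (p / x) p m / finPoch p p m) / (z - p ^ m) := by
  have hinj := pow_injective_of_norm_lt_one hp0 hp
  have hinterp := Lagrange.eq_interpolate (s := range (M + 1)) (v := fun j : ℕ => p ^ j)
    (f := Lagrange.nodal (range M) fun j : ℕ => x * p ^ j) hinj.injOn
    (by rw [Lagrange.degree_nodal, card_range, card_range]; exact_mod_cast M.lt_succ_self)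
  have heval := congrArg (Polynomial.eval z) hinterp
  rw [Lagrange.eval_interpolate_not_at_node _ hz, Lagrange.eval_nodal, Lagrange.eval_nodal]
    at heval
  rw [heval]
  congr 1
  refine sum_congr rfl fun m hm => ?_
  obtain ⟨L, rfl⟩ : ∃ L, M = m + L := ⟨M - m, by have := mem_range.mp hm; omega⟩
  have hpp := finPoch_ne_zero (one_sub_mul_pow_ne_zero hp hp)
  have hnum : ∏ j ∈ range (m + L), (p ^ m - x * p ^ j) = x ^ m * (∏ j ∈ range m, -p ^ j) *
      finPoch (p / x) p m * ((p ^ m) ^ L * finPoch x p L) := by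
    have h1 := prod_low_factors (p := p) hx 1 m
    have h2 := prod_high_factors one_ne_zero p x m L
    simp only [mul_one, div_one] at h1 h2
    rw [prod_range_add, h1, h2]
  have hden : ∏ j ∈ (range (m + L + 1)).erase m, (p ^ m - p ^ j) = (∏ j ∈ range m, -p ^ j) *
      finPoch p p m * ((p ^ m) ^ L * finPoch p p L) := by
    have h1 := prod_low_factors (p := p) one_ne_zero 1 m
    have h2 := prod_high_factors one_ne_zero p p m L
    simp only [mul_one, div_one, one_mul, one_pow] at h1 h2
    have hset : (range (m + L + 1)).erase m
        = (range m).disjUnion ((range L).map (addLeftEmbedding (m + 1)))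
          (by
            rw [Finset.disjoint_left]
            intro a ha hb
            simp at ha hb
            omega) := by
      ext a
      simp only [mem_erase, mem_range, mem_disjUnion, Finset.mem_map, addLeftEmbedding_apply]
      constructor
      · intro h
        by_cases ha : a < m
        · exact Or.inl ha
        · exact Or.inr ⟨a - (m + 1), by omega, by omega⟩
      · rintro (h | ⟨b, hb, rfl⟩) <;> omega
    rw [hset, prod_disjUnion, prod_map, h1, ← h2]
    congr 1
    refine prod_congr rfl fun j _ => ?_
    simp only [addLeftEmbedding_apply]
    ring
  have hD : ∏ j ∈ range m, -p ^ j ≠ 0 :=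
    prod_ne_zero_iff.mpr fun j _ => neg_ne_zero.mpr (pow_ne_zero j hp0)
  have hzm : z - p ^ m ≠ 0 := sub_ne_zero.mpr (hz m hm)
  have hm1 := hpp m
  have hL1 := hpp L
  rw [Lagrange.nodalWeight, prod_inv_distrib, hden, Lagrange.eval_nodal, hnum,
    Nat.add_sub_cancel_left]
  field_simp

lemma kronecker_finite {p x y : ℂ} (hp0 : p ≠ 0) (hp : ‖p‖ < 1) (hx : x ≠ 0) (hy0 : y ≠ 0)
    (hy : ∀ n : ℕ, 1 - y * p ^ n ≠ 0) (hy' : ∀ n : ℕ, 1 - p / y * p ^ n ≠ 0) (N : ℕ) :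
    finPoch (x * y) p N * finPoch (p / (x * y)) p (N + 1)
        / (finPoch y p (N + 1) * finPoch (p / y) p (N + 1))
      = (∑ n ∈ range (N + 1), x ^ n / (1 - y * p ^ n) *
          (finPoch x p (N - n) / finPoch p p (N - n)) *
          (finPoch (p / x) p (N + 1 + n) / finPoch p p (N + 1 + n)))
        - ∑ n ∈ range (N + 1), (p / x) ^ (n + 1) / y / (1 - p / y * p ^ n) *
          (finPoch (p / x) p (N - n) / finPoch p p (N - n)) *
          (finPoch x p (N + 1 + n) / finPoch p p (N + 1 + n)) := by
  have hlow : ∀ m n : ℕ, m + (n + 1) = N + 1 → p ^ (N + 1) * y⁻¹ - p ^ m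
      = -(p ^ (N + 1) / p ^ (n + 1)) * (1 - p / y * p ^ n) := by
    intro m n h
    rw [← h, pow_add]
    field_simp
    ring
  have hhigh : ∀ n : ℕ, p ^ (N + 1) * y⁻¹ - p ^ (N + 1 + n)
      = p ^ (N + 1) / y * (1 - y * p ^ n) := by
    intro n
    rw [pow_add]
    field_simp
    ring
  have hz : ∀ m ∈ range (2 * N + 1 + 1), p ^ (N + 1) * y⁻¹ ≠ p ^ m := by
    intro m _
    rw [← sub_ne_zero]
    rcases lt_or_ge m (N + 1) with h | h
    · obtain ⟨n, hn⟩ : ∃ n, m + (n + 1) = N + 1 := ⟨N - m, by omega⟩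
      rw [hlow m n hn]
      exact mul_ne_zero (neg_ne_zero.mpr (div_ne_zero (pow_ne_zero _ hp0) (pow_ne_zero _ hp0)))
        (hy' n)
    · obtain ⟨n, rfl⟩ := Nat.exists_eq_add_of_le h
      rw [hhigh n]
      exact mul_ne_zero (div_ne_zero (pow_ne_zero _ hp0) hy0) (hy n)
  have key := partial_fractions hp0 hp hx (2 * N + 1) hz
  have hnum := prod_low_factors (p := p) hx y⁻¹ (N + 1)
  have hnum' := prod_high_factors (inv_ne_zero hy0) p x (N + 1) N
  have hden := prod_low_factors (p := p) one_ne_zero y⁻¹ (N + 1)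
  have hden' := prod_high_factors (inv_ne_zero hy0) p 1 (N + 1) (N + 1)
  simp only [one_mul, one_pow, div_one, div_inv_eq_mul] at hnum hnum' hden hden'
  have hxy : p * y⁻¹ / x = p / (x * y) := by field_simp
  rw [show 2 * N + 1 + 1 = (N + 1) + (N + 1) by ring, show 2 * N + 1 = (N + 1) + N by ring,
    prod_range_add _ (N + 1) N, prod_range_add _ (N + 1) (N + 1), hnum, hnum', hden, hden', hxy, ← div_eq_mul_inv p y,
    sum_range_add] at key
  rw [← sum_range_reflect] at key
  have hD : ∏ j ∈ range (N + 1), -p ^ j ≠ 0 :=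
    prod_ne_zero_iff.mpr fun j _ => neg_ne_zero.mpr (pow_ne_zero j hp0)
  have hS1 : ∑ j ∈ range (N + 1), x ^ (N + 1 - 1 - j) *
        (finPoch x p (N + 1 + N - (N + 1 - 1 - j)) / finPoch p p (N + 1 + N - (N + 1 - 1 - j))) *
        (finPoch (p / x) p (N + 1 - 1 - j) / finPoch p p (N + 1 - 1 - j)) /
          (p ^ (N + 1) * y⁻¹ - p ^ (N + 1 - 1 - j))
      = -(x ^ (N + 1) * y / p ^ (N + 1)) *
        ∑ n ∈ range (N + 1), (p / x) ^ (n + 1) / y / (1 - p / y * p ^ n) *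
          (finPoch (p / x) p (N - n) / finPoch p p (N - n)) *
          (finPoch x p (N + 1 + n) / finPoch p p (N + 1 + n)) := by
    rw [mul_sum]
    refine sum_congr rfl fun n hn => ?_
    have hn' := mem_range.mp hn
    have hne := hy' n
    rw [hlow (N + 1 - 1 - n) n (by omega), show N + 1 - 1 - n = N - n by omega,
      show N + 1 + N - (N - n) = N + 1 + n by omega,
      show x ^ (N + 1) = x ^ (N - n) * x ^ (n + 1) by rw [← pow_add]; congr 1; omega, div_pow]
    generalize finPoch x p (N + 1 + n) / finPoch p p (N + 1 + n) = A
    generalize finPoch (p / x) p (N - n) / finPoch p p (N - n) = B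
    generalize 1 - p / y * p ^ n = C at hne ⊢
    field_simp
  have hS2 : ∑ n ∈ range (N + 1), x ^ (N + 1 + n) *
        (finPoch x p (N + 1 + N - (N + 1 + n)) / finPoch p p (N + 1 + N - (N + 1 + n))) *
        (finPoch (p / x) p (N + 1 + n) / finPoch p p (N + 1 + n)) /
          (p ^ (N + 1) * y⁻¹ - p ^ (N + 1 + n))
      = (x ^ (N + 1) * y / p ^ (N + 1)) *
        ∑ n ∈ range (N + 1), x ^ n / (1 - y * p ^ n) *
          (finPoch x p (N - n) / finPoch p p (N - n)) *
          (finPoch (p / x) p (N + 1 + n) / finPoch p p (N + 1 + n)) := by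
    rw [mul_sum]
    refine sum_congr rfl fun n hn => ?_
    have hne := hy n
    rw [hhigh n, show N + 1 + N - (N + 1 + n) = N - n by omega, pow_add x]
    generalize finPoch x p (N - n) / finPoch p p (N - n) = A
    generalize finPoch (p / x) p (N + 1 + n) / finPoch p p (N + 1 + n) = B
    generalize 1 - y * p ^ n = C at hne ⊢
    field_simp
  rw [hS1, hS2] at key
  have h1 := finPoch_ne_zero hy (N + 1)
  have h2 := finPoch_ne_zero hy' (N + 1)
  rw [div_eq_iff (mul_ne_zero h1 h2)]
  have hc : (∏ j ∈ range (N + 1), -p ^ j) * x ^ (N + 1) * (p ^ (N + 1) * y⁻¹) ^ N ≠ 0 :=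
    mul_ne_zero (mul_ne_zero hD (pow_ne_zero _ hx))
      (pow_ne_zero _ (mul_ne_zero (pow_ne_zero _ hp0) (inv_ne_zero hy0)))
  have hcancel : p ^ (N + 1) * y⁻¹ * (x ^ (N + 1) * y / p ^ (N + 1)) = x ^ (N + 1) := by
    field_simp
  apply mul_left_cancel₀ hc
  generalize (∑ n ∈ range (N + 1), x ^ n / (1 - y * p ^ n) *
          (finPoch x p (N - n) / finPoch p p (N - n)) *
          (finPoch (p / x) p (N + 1 + n) / finPoch p p (N + 1 + n))) = S at key ⊢
  generalize (∑ n ∈ range (N + 1), (p / x) ^ (n + 1) / y / (1 - p / y * p ^ n) *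
          (finPoch (p / x) p (N - n) / finPoch p p (N - n)) *
          (finPoch x p (N + 1 + n) / finPoch p p (N + 1 + n))) = T at key ⊢
  rw [pow_succ (p ^ (N + 1) * y⁻¹) N] at key
  linear_combination key + (∏ j ∈ range (N + 1), -p ^ j) * (p ^ (N + 1) * y⁻¹) ^ N *
    finPoch y p (N + 1) * finPoch (p / y) p (N + 1) * (S - T) * hcancel

lemma tendsto_sum_mul_mul {g a b : ℕ → ℂ} {A B : ℂ} (hg : Summable fun n => ‖g n‖)
    (ha : Tendsto a atTop (𝓝 A)) (hb : Tendsto b atTop (𝓝 B)) :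
    Tendsto (fun N => ∑ n ∈ range (N + 1), g n * a (N - n) * b (N + 1 + n)) atTop
      (𝓝 ((∑' n, g n) * A * B)) := by
  obtain ⟨C, hC⟩ := ha.norm.bddAbove_range
  obtain ⟨D, hD⟩ := hb.norm.bddAbove_range
  have hC' : ∀ n, ‖a n‖ ≤ C := fun n => hC ⟨n, rfl⟩
  have hD' : ∀ n, ‖b n‖ ≤ D := fun n => hD ⟨n, rfl⟩
  have hC0 : 0 ≤ C := (norm_nonneg _).trans (hC' 0)
  have hD0 : 0 ≤ D := (norm_nonneg _).trans (hD' 0)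
  have h := tendsto_tsum_of_dominated_convergence (𝓕 := atTop)
    (f := fun N n => if n ∈ range (N + 1) then g n * a (N - n) * b (N + 1 + n) else 0)
    (g := fun n => g n * A * B) (bound := fun n => ‖g n‖ * C * D)
    ((hg.mul_right C).mul_right D) ?_ ?_
  · rw [tsum_mul_right, tsum_mul_right] at h
    refine h.congr fun N => ?_
    rw [tsum_eq_sum (s := range (N + 1)) (fun n hn => if_neg hn)]
    exact sum_congr rfl fun n hn => if_pos hn
  · intro n
    have h1 : Tendsto (fun N => g n * a (N - n) * b (N + 1 + n)) atTop (𝓝 (g n * A * B)) :=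
      (tendsto_const_nhds.mul (ha.comp (tendsto_sub_atTop_nat n))).mul
        (hb.comp (tendsto_atTop_mono (fun N => show N ≤ N + 1 + n by omega) tendsto_id))
    refine h1.congr' ?_
    filter_upwards [eventually_ge_atTop n] with N hN
    rw [if_pos (mem_range.mpr (by omega))]
  · refine Eventually.of_forall fun N n => ?_
    split_ifs
    · rw [norm_mul, norm_mul]
      gcongr
      · exact hC' _
      · exact hD' _
    · rw [norm_zero]
      positivity

lemma summable_norm_pow_div {p x : ℂ} (hp : ‖p‖ < 1) (hx : ‖x‖ < 1) (y : ℂ) :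
    Summable fun n : ℕ => ‖x ^ n / (1 - y * p ^ n)‖ := by
  have h0 : Tendsto (fun n : ℕ => (1 - y * p ^ n)⁻¹) atTop (𝓝 (1 - y * 0)⁻¹) :=
    (((tendsto_pow_atTop_nhds_zero_of_norm_lt_one hp).const_mul y).const_sub 1).inv₀ (by simp)
  obtain ⟨C, hC⟩ := h0.norm.bddAbove_range
  refine Summable.of_nonneg_of_le (fun n => norm_nonneg _) (fun n => ?_)
    ((summable_geometric_of_lt_one (norm_nonneg x) hx).mul_right C)
  rw [div_eq_mul_inv, norm_mul, norm_pow]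
  exact mul_le_mul_of_nonneg_left (hC ⟨n, rfl⟩) (by positivity)

/-- Kronecker's identity
`∑_{n ∈ ℤ} xⁿ/(1 - y pⁿ) = (p, p, xy, p/(xy); p)_∞ / (x, p/x, y, p/y; p)_∞` for `|p| < |x| < 1`,
with the terms of negative index rewritten in powers of `p/x`. -/
theorem kronecker {p x y : ℂ} (hp0 : p ≠ 0) (hp : ‖p‖ < 1) (hx : x ≠ 0) (hx1 : ‖x‖ < 1)
    (hpx : ‖p / x‖ < 1) (hy0 : y ≠ 0)
    (hy : ∀ n : ℕ, 1 - y * p ^ n ≠ 0) (hy' : ∀ n : ℕ, 1 - p / y * p ^ n ≠ 0) :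
    (∑' n : ℕ, x ^ n / (1 - y * p ^ n)) - ∑' n : ℕ, (p / x) ^ (n + 1) / y / (1 - p / y * p ^ n)
      = poch (x * y) p * poch (p / (x * y)) p / (poch y p * poch (p / y) p)
        * (poch p p * poch p p) / (poch x p * poch (p / x) p) := by
  have hP : poch p p ≠ 0 := poch_ne_zero hp (one_sub_mul_pow_ne_zero hp hp)
  have hX : poch x p ≠ 0 := poch_ne_zero hp (one_sub_mul_pow_ne_zero hp hx1)
  have hX' : poch (p / x) p ≠ 0 := poch_ne_zero hp (one_sub_mul_pow_ne_zero hp hpx)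
  have hA := (tendsto_finPoch hp x).div (tendsto_finPoch hp p) hP
  have hB := (tendsto_finPoch hp (p / x)).div (tendsto_finPoch hp p) hP
  have hg2 : Summable fun n : ℕ => ‖(p / x) ^ (n + 1) / y / (1 - p / y * p ^ n)‖ := by
    refine ((summable_norm_pow_div hp hpx (p / y)).mul_left ‖p / x / y‖).congr fun n => ?_
    rw [← norm_mul]
    congr 1
    ring
  have hR := (tendsto_sum_mul_mul (summable_norm_pow_div hp hx1 y) hA hB).sub
    (tendsto_sum_mul_mul hg2 hB hA)
  have hs := tendsto_add_atTop_nat 1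
  have hL := ((tendsto_finPoch hp (x * y)).mul ((tendsto_finPoch hp (p / (x * y))).comp hs)).div
    (((tendsto_finPoch hp y).comp hs).mul ((tendsto_finPoch hp (p / y)).comp hs))
    (mul_ne_zero (poch_ne_zero hp hy) (poch_ne_zero hp hy'))
  have heq := tendsto_nhds_unique
    (hL.congr fun N => kronecker_finite hp0 hp hx hy0 hy hy' N) hR
  rw [heq]
  field_simp

/-- Identity (2.5):
`∑_{n≥0} qⁿ/(1 − q^{5n+2}) − ∑_{n≥0} q^{4n+2}/(1 − q^{5n+3})
  = (q⁵, q⁵; q⁵)_∞ / (q, q⁴; q⁵)_∞` for `|q| < 1`. -/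
theorem statement_8 (q : ℂ) (hq : ‖q‖ < 1) :
    (∑' n : ℕ, q ^ n / (1 - q ^ (5 * n + 2)))
      - ∑' n : ℕ, q ^ (4 * n + 2) / (1 - q ^ (5 * n + 3))
    = (poch (q ^ 5) (q ^ 5) * poch (q ^ 5) (q ^ 5))
      / (poch q (q ^ 5) * poch (q ^ 4) (q ^ 5)) := by
  rcases eq_or_ne q 0 with rfl | hq0
  · have h1 : (∑' n : ℕ, (0 : ℂ) ^ n / (1 - 0 ^ (5 * n + 2))) = 1 := by
      rw [tsum_eq_single 0 (fun n hn => by simp [hn])]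
      simp
    rw [h1]
    simp [poch]
  have h5 : q ^ 5 ≠ 0 := pow_ne_zero 5 hq0
  have hlt : ∀ k : ℕ, k ≠ 0 → ‖q ^ k‖ < 1 := fun k hk => by
    rw [norm_pow]
    exact pow_lt_one₀ (norm_nonneg q) hq hk
  have h51 : q ^ 5 / q = q ^ 4 := by field_simp
  have h52 : q ^ 5 / q ^ 2 = q ^ 3 := by field_simp
  have h12 : q * q ^ 2 = q ^ 3 := by ring
  have h53 : q ^ 5 / q ^ 3 = q ^ 2 := by field_simp
  have hne2 := one_sub_mul_pow_ne_zero (hlt 5 (by simp)) (hlt 2 (by simp))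
  have hne3 := one_sub_mul_pow_ne_zero (hlt 5 (by simp)) (hlt 3 (by simp))
  have key := kronecker h5 (hlt 5 (by simp)) hq0 hq (by rw [h51]; exact hlt 4 (by simp))
    (pow_ne_zero 2 hq0) hne2 (by rw [h52]; exact hne3)
  rw [h51, h52, h12, h53, mul_comm (poch (q ^ 3) (q ^ 5)), div_self (mul_ne_zero
    (poch_ne_zero (hlt 5 (by simp)) hne2) (poch_ne_zero (hlt 5 (by simp)) hne3)), one_mul] at key
  rw [← key]
  congr 1
  · refine tsum_congr fun n => ?_
    rw [← pow_mul, ← pow_add, add_comm]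
  · refine tsum_congr fun n => ?_
    rw [← pow_mul, ← pow_mul, ← pow_add, add_comm 3]
    congr 1
    rw [eq_div_iff (pow_ne_zero 2 hq0)]
    ring

end Beck
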